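/- Assume the heterogeneous quorum system 𝓠 has quorum sharing. Then the well-behaved processes in any minimal quorum of 𝓠 form a clique in the quorum graph: for every minimal quorum q of 𝓠 and all processes p, p' ∈ q ∩ 𝓦, there is an edge from p to p' in the quorum graph. -/

import Mathlib

open Finset

/-- A heterogeneous quorum system on the (finite) set of processes `α`:
each process is assigned a nonempty antichain of nonempty finite sets of
processes, its individual minimal quorums. -/
structure HQS (α : Type*) where
  /-- the individual minimal quorums of each process -/
  Q : α → Finset (Finset α)
  Q_nonempty : ∀ p, (Q p).Nonempty
  quorum_nonempty : ∀ p, ∀ q ∈ Q p, q.Nonempty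
  antichain : ∀ p, ∀ q ∈ Q p, ∀ q' ∈ Q p, ¬ q ⊂ q'

variable {α : Type*}

/-- `q` is a quorum of the system: an individual minimal quorum of some process. -/
def HQS.IsQuorum (S : HQS α) (q : Finset α) : Prop := ∃ p, q ∈ S.Q p

/-- `q` is a minimal quorum of the system: a quorum no proper subset of which
is a quorum. -/
def HQS.IsMinimalQuorum (S : HQS α) (q : Finset α) : Prop :=
  S.IsQuorum q ∧ ∀ q' ⊂ q, ¬ S.IsQuorum q'

/-- Edge of the quorum graph: `p` has `p'` in one of its individual minimal quorums. -/
def HQS.Edge (S : HQS α) (p p' : α) : Prop := ∃ q ∈ S.Q p, p' ∈ q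

/-- Reachability by a directed path in the quorum graph. -/
def HQS.Reach (S : HQS α) : α → α → Prop := Relation.ReflTransGen S.Edge

/-- Two vertices are in the same strongly connected component. -/
def HQS.SameSCC (S : HQS α) (p p' : α) : Prop := S.Reach p p' ∧ S.Reach p' p

/-- `C` is a strongly connected component of the quorum graph. -/
def HQS.IsSCC (S : HQS α) (C : Set α) : Prop := ∃ v, C = {u | S.SameSCC u v}

/-- `C` is a sink component: an SCC such that every edge leaving a vertex of `C`
ends in `C`. -/
def HQS.IsSinkComponent (S : HQS α) (C : Set α) : Prop :=
  S.IsSCC C ∧ ∀ p ∈ C, ∀ p', S.Edge p p' → p' ∈ C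

/-- under quorum sharing, the well-behaved processes in any
minimal quorum form a clique in the quorum graph. -/
theorem stmt_7 [Fintype α] [DecidableEq α] (S : HQS α) (𝓦 : Finset α)
    (hshare : ∀ p : α, ∀ q ∈ S.Q p, ∀ p' ∈ q, ∃ q' ∈ S.Q p', q' ⊆ q)
    (q : Finset α) (hq : S.IsMinimalQuorum q)
    (p p' : α) (hp : p ∈ q ∩ 𝓦) (hp' : p' ∈ q ∩ 𝓦) :
    S.Edge p p' := by
  obtain ⟨⟨r, hr⟩, hmin⟩ := hq
  obtain ⟨q', hq', hsub⟩ := hshare r q hr p (Finset.mem_inter.mp hp).1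
  refine ⟨q', hq', ?_⟩
  rcases hsub.eq_or_ssubset with h | h
  · rw [h]
    exact (Finset.mem_inter.mp hp').1
  · exact absurd ⟨p, hq'⟩ (hmin q' h)
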